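/- Define, for x̃ ∈ ℂ, m(x̃) = (1−λ)·φ_{τ²}(x̃) + λ·∫_ℂ p_H(x)·φ_{τ²}(x̃−x) dx, B(x̃) = λ·∫_ℂ x·p_H(x)·φ_{τ²}(x̃−x) dx, and A(x̃) = λ·∫_ℂ |x|²·p_H(x)·φ_{τ²}(x̃−x) dx. Then the Bayes risk (MSE of the MMSE denoiser for the prior (1−λ)δ₀ + λ·p_H under complex Gaussian noise of variance τ²) satisfies ∫_ℂ (A(x̃) − |B(x̃)|²/m(x̃)) dx̃ = ∫₀^∞ a·Q(g)·g^{−γ}·(λ·g²·τ²/(g²+τ²)) dg + ∫₀^∞ a·λ·s·(μ₁(s) − ν₁(s)²/ξ₁(s)) ds. -/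

import Mathlib

open MeasureTheory Set
open scoped ENNReal

noncomputable section

/-- `Q(g) = ∫_{b ln g + c}^∞ exp(-s²) ds`. -/
def Qfun (b c g : ℝ) : ℝ := ∫ s in Set.Ioi (b * Real.log g + c), Real.exp (-s ^ 2)

/-- Circularly symmetric complex Gaussian density of variance `v` on `ℂ ≅ ℝ²`. -/
def cgauss (v : ℝ) (x : ℂ) : ℝ := (Real.pi * v)⁻¹ * Real.exp (-‖x‖ ^ 2 / v)

/-- Channel density `p_H(h) = (a/π)∫₀^∞ g^{-γ-2} Q(g) exp(-|h|²/g²) dg`. -/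
def pH (a γ b c : ℝ) (h : ℂ) : ℝ :=
  (a / Real.pi) * ∫ g in Set.Ioi (0 : ℝ), g ^ (-γ - 2) * Qfun b c g * Real.exp (-‖h‖ ^ 2 / g ^ 2)

/-- `ν_i(s) = ∫₀^∞ g^{2-γ} Q(g) (g²+τ²)^{-(i+1)} exp(-s/(g²+τ²)) dg`. -/
def nufun (γ b c τ : ℝ) (i : ℕ) (s : ℝ) : ℝ :=
  ∫ g in Set.Ioi (0 : ℝ),
    g ^ (2 - γ) * Qfun b c g / (g ^ 2 + τ ^ 2) ^ (i + 1) * Real.exp (-s / (g ^ 2 + τ ^ 2))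

/-- `ξ_i(s) = ((1-λ)/(λ a τ^{2i})) exp(-s/τ²) + ∫₀^∞ g^{-γ} Q(g) (g²+τ²)^{-i} exp(-s/(g²+τ²)) dg`. -/
def xifun (a γ b c τ lam : ℝ) (i : ℕ) (s : ℝ) : ℝ :=
  (1 - lam) / (lam * a * τ ^ (2 * i)) * Real.exp (-s / τ ^ 2) +
    ∫ g in Set.Ioi (0 : ℝ),
      g ^ (-γ) * Qfun b c g / (g ^ 2 + τ ^ 2) ^ i * Real.exp (-s / (g ^ 2 + τ ^ 2))

/-- `μ_i(s) = ∫₀^∞ g^{4-γ} Q(g) (g²+τ²)^{-(i+2)} exp(-s/(g²+τ²)) dg`. -/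
def mufun (γ b c τ : ℝ) (i : ℕ) (s : ℝ) : ℝ :=
  ∫ g in Set.Ioi (0 : ℝ),
    g ^ (4 - γ) * Qfun b c g / (g ^ 2 + τ ^ 2) ^ (i + 2) * Real.exp (-s / (g ^ 2 + τ ^ 2))

theorem integral_comp_normSq (f : ℝ → ℝ) :
    ∫ x : ℂ, f (‖x‖ ^ 2) = Real.pi * ∫ s in Ioi (0 : ℝ), f s := by
  rw [integral_fun_norm_addHaar volume (fun r => f (r ^ 2)),
    ← integral_comp_rpow_Ioi_of_pos (g := f) (p := 2) (by norm_num)]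
  have hball : volume.real (Metric.ball (0 : ℂ) 1) = Real.pi := by
    simp [Measure.real, Complex.volume_ball]
  rw [hball, Complex.finrank_real_complex, two_smul, ← two_mul, smul_eq_mul, mul_left_comm,
    ← integral_const_mul]
  congr 1
  refine setIntegral_congr_fun measurableSet_Ioi fun r _ => ?_
  norm_num [mul_assoc]

theorem integrable_comp_normSq_iff (f : ℝ → ℝ) :
    Integrable (fun x : ℂ => f (‖x‖ ^ 2)) ↔ IntegrableOn f (Ioi 0) := by
  rw [integrable_fun_norm_addHaar volume (f := fun r => f (r ^ 2)),
    ← integrableOn_Ioi_comp_rpow_iff' f (p := 2) (by norm_num)]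
  norm_num [Complex.finrank_real_complex]

theorem integrableOn_pow_mul_exp_neg_div {v : ℝ} (hv : 0 < v) (k : ℕ) :
    IntegrableOn (fun s : ℝ => s ^ k * Real.exp (-s / v)) (Ioi 0) := by
  have h := integrableOn_rpow_mul_exp_neg_mul_rpow (s := k) (p := 1) (b := v⁻¹)
    (by have := k.cast_nonneg (α := ℝ); linarith) one_pos (by positivity)
  simpa [div_eq_mul_inv, mul_comm] using h

theorem integral_pow_mul_exp_neg_div {v : ℝ} (hv : 0 < v) (k : ℕ) :
    ∫ s in Ioi (0 : ℝ), s ^ k * Real.exp (-s / v) = k.factorial * v ^ (k + 1) := by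
  have h := Real.integral_rpow_mul_exp_neg_mul_Ioi (a := k + 1) (r := v⁻¹) (by positivity)
    (by positivity)
  rw [Real.Gamma_nat_eq_factorial, mul_comm _ (k.factorial : ℝ)] at h
  simp only [add_sub_cancel_right, Real.rpow_natCast, one_div, inv_inv] at h
  norm_cast at h
  simpa [div_eq_mul_inv, mul_comm] using h

theorem cgauss_nonneg {v : ℝ} (hv : 0 < v) (x : ℂ) : 0 ≤ cgauss v x := by
  unfold cgauss; positivity

theorem continuous_cgauss (v : ℝ) : Continuous (cgauss v) := by
  unfold cgauss; fun_prop

theorem cgauss_neg (v : ℝ) (x : ℂ) : cgauss v (-x) = cgauss v x := by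
  simp [cgauss]

theorem integrable_cgauss {v : ℝ} (hv : 0 < v) : Integrable (cgauss v) :=
  (integrable_comp_normSq_iff fun s => (Real.pi * v)⁻¹ * Real.exp (-s / v)).2
    (by
      have h := integrableOn_pow_mul_exp_neg_div hv 0
      simp only [pow_zero, one_mul] at h
      exact h.const_mul _)

theorem integral_cgauss {v : ℝ} (hv : 0 < v) : ∫ x, cgauss v x = 1 := by
  have h := integral_comp_normSq fun s => (Real.pi * v)⁻¹ * Real.exp (-s / v)
  have h0 := integral_pow_mul_exp_neg_div hv 0
  simp only [pow_zero, one_mul, zero_add, pow_one, Nat.factorial_zero, Nat.cast_one] at h0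
  rw [integral_const_mul _ fun s => Real.exp (-s / v), h0] at h
  refine h.trans ?_
  have := Real.pi_pos
  field_simp

theorem integrable_normSq_mul_cgauss {v : ℝ} (hv : 0 < v) :
    Integrable fun x => ‖x‖ ^ 2 * cgauss v x := by
  refine (integrable_comp_normSq_iff fun s => s * ((Real.pi * v)⁻¹ * Real.exp (-s / v))).2 ?_
  simp_rw [mul_left_comm _ (Real.pi * v)⁻¹]
  have h := integrableOn_pow_mul_exp_neg_div hv 1
  simp only [pow_one] at h
  exact h.const_mul _

theorem integral_normSq_mul_cgauss {v : ℝ} (hv : 0 < v) :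
    ∫ x, ‖x‖ ^ 2 * cgauss v x = v := by
  have h := integral_comp_normSq fun s => s * ((Real.pi * v)⁻¹ * Real.exp (-s / v))
  simp_rw [mul_left_comm _ (Real.pi * v)⁻¹] at h
  have h1 := integral_pow_mul_exp_neg_div hv 1
  simp only [pow_one, one_add_one_eq_two, Nat.factorial_one, Nat.cast_one, one_mul] at h1
  rw [integral_const_mul _ fun s => s * Real.exp (-s / v), h1] at h
  simp only [cgauss]
  simp_rw [mul_left_comm _ (Real.pi * v)⁻¹]
  refine h.trans ?_
  have := Real.pi_pos
  field_simp

/-- Functions of at most quadratic growth are integrable against a Gaussian density. -/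
theorem integrable_smul_cgauss {E : Type*} [NormedAddCommGroup E] [NormedSpace ℝ E] {v : ℝ}
    (hv : 0 < v) {f : ℂ → E} (hf : Continuous f) {C : ℝ} (hfC : ∀ x, ‖f x‖ ≤ C * (1 + ‖x‖ ^ 2)) :
    Integrable fun x => cgauss v x • f x := by
  refine Integrable.mono' (((integrable_cgauss hv).add
    (integrable_normSq_mul_cgauss hv)).const_mul C)
    ((continuous_cgauss v).smul hf).aestronglyMeasurable (.of_forall fun x => ?_)
  rw [norm_smul, Real.norm_of_nonneg (cgauss_nonneg hv x)]
  refine (mul_le_mul_of_nonneg_left (hfC x) (cgauss_nonneg hv x)).trans_eq ?_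
  simp only [Pi.add_apply]
  ring

theorem integral_mul_cgauss_eq_zero (v : ℝ) : ∫ x : ℂ, cgauss v x • x = 0 := by
  have h := integral_neg_eq_self (fun x : ℂ => cgauss v x • x) volume
  simp only [cgauss_neg, smul_neg, integral_neg] at h
  exact self_eq_neg.1 h.symm

theorem integral_mul_cgauss_sub {v : ℝ} (hv : 0 < v) (z : ℂ) :
    ∫ x : ℂ, cgauss v (x - z) • x = z := by
  rw [← integral_add_right_eq_self _ z]
  simp only [add_sub_cancel_right, smul_add]
  rw [integral_add, integral_mul_cgauss_eq_zero, integral_smul_const, integral_cgauss hv]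
  · simp
  · exact integrable_smul_cgauss hv continuous_id (C := 1) fun x => by
      nlinarith [sq_nonneg (‖x‖ - 1)]
  · exact (integrable_cgauss hv).smul_const z

theorem integral_normSq_mul_cgauss_sub {v : ℝ} (hv : 0 < v) (z : ℂ) :
    ∫ x : ℂ, cgauss v (x - z) * ‖x‖ ^ 2 = v + ‖z‖ ^ 2 := by
  rw [← integral_add_right_eq_self _ z]
  have hexp : ∀ x : ℂ, cgauss v (x + z - z) * ‖x + z‖ ^ 2 =
      ‖x‖ ^ 2 * cgauss v x + 2 * inner ℝ z (cgauss v x • x) + cgauss v x * ‖z‖ ^ 2 := fun x => by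
    rw [add_sub_cancel_right, norm_add_sq_real, inner_smul_right, real_inner_comm]
    ring
  have hi : Integrable fun x : ℂ => cgauss v x • x :=
    integrable_smul_cgauss hv continuous_id (C := 1) fun x => by
      nlinarith [sq_nonneg (‖x‖ - 1)]
  have hi' : Integrable fun x : ℂ => 2 * inner ℝ z (cgauss v x • x) :=
    (hi.const_inner z).const_mul 2
  have h1 := integrable_normSq_mul_cgauss hv
  have hi'' : Integrable fun x : ℂ => ‖x‖ ^ 2 * cgauss v x + 2 * inner ℝ z (cgauss v x • x) :=
    h1.add hi'
  simp_rw [hexp]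
  rw [integral_add hi'' ((integrable_cgauss hv).mul_const _), integral_add h1 hi',
    integral_normSq_mul_cgauss hv, integral_const_mul, integral_inner hi,
    integral_mul_cgauss_eq_zero, integral_mul_const, integral_cgauss hv]
  simp

/-- Completing the square: a product of Gaussian densities is evidence times posterior. -/
theorem cgauss_mul_cgauss_sub {u t : ℝ} (hu : 0 < u) (ht : 0 < t) (x y : ℂ) :
    cgauss u x * cgauss t (y - x) =
      cgauss (u + t) y * cgauss (u * t / (u + t)) (x - ((u / (u + t) : ℝ) : ℂ) * y) := by
  have hn : ∀ z : ℂ, ‖z‖ ^ 2 = z.re ^ 2 + z.im ^ 2 := fun z => by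
    rw [← Complex.normSq_eq_norm_sq, Complex.normSq_apply]; ring
  have hv : u + t ≠ 0 := by positivity
  have hpi := Real.pi_pos
  unfold cgauss
  rw [mul_mul_mul_comm, mul_mul_mul_comm (Real.pi * (u + t))⁻¹, ← Real.exp_add, ← Real.exp_add]
  congr 1
  · field_simp
  · congr 1
    simp only [hn, Complex.sub_re, Complex.sub_im, Complex.re_ofReal_mul, Complex.im_ofReal_mul]
    field_simp
    ring

theorem integrable_smul_cgauss_sub {E : Type*} [NormedAddCommGroup E] [NormedSpace ℝ E] {v : ℝ}
    (hv : 0 < v) (z : ℂ) {f : ℂ → E} (hf : Continuous f) {C : ℝ}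
    (hfC : ∀ x, ‖f x‖ ≤ C * (1 + ‖x‖ ^ 2)) :
    Integrable fun x => cgauss v (x - z) • f x := by
  have hsq : Integrable fun x => cgauss v (x - z) * ‖x‖ ^ 2 :=
    .of_integral_ne_zero (by rw [integral_normSq_mul_cgauss_sub hv]; positivity)
  refine Integrable.mono' ((((integrable_cgauss hv).comp_sub_right z).add hsq).const_mul C)
    (((continuous_cgauss v).comp (by fun_prop)).smul hf).aestronglyMeasurable
    (.of_forall fun x => ?_)
  rw [norm_smul, Real.norm_of_nonneg (cgauss_nonneg hv _)]
  refine (mul_le_mul_of_nonneg_left (hfC x) (cgauss_nonneg hv _)).trans_eq ?_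
  simp only [Pi.add_apply]
  ring

theorem cgauss_le {v : ℝ} (hv : 0 < v) (x : ℂ) : cgauss v x ≤ (Real.pi * v)⁻¹ := by
  have hpi := Real.pi_pos
  refine mul_le_of_le_one_right (by positivity) (Real.exp_le_one_iff.2 ?_)
  rw [neg_div]
  simp only [Left.neg_nonpos_iff]
  positivity

theorem integrable_scaleMixture_prod {E : Type*} [NormedAddCommGroup E] [NormedSpace ℝ E]
    {W : ℝ → ℝ} (hW : IntegrableOn W (Ioi 0)) {t : ℝ} (ht : 0 < t) (y : ℂ) {f : ℂ → E}
    (hf : Continuous f) {C : ℝ} (hfC : ∀ x, ‖f x‖ ≤ C * (1 + ‖x‖ ^ 2)) :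
    Integrable (fun p : ℂ × ℝ => (W p.2 * cgauss (p.2 ^ 2) p.1 * cgauss t (y - p.1)) • f p.1)
      ((volume : Measure ℂ).prod (volume.restrict (Ioi 0))) := by
  have hC : 0 ≤ C := by
    have h := (norm_nonneg _).trans (hfC 0)
    simpa using h
  have hpi := Real.pi_pos
  have hmeas : AEStronglyMeasurable
      (fun p : ℂ × ℝ => (W p.2 * cgauss (p.2 ^ 2) p.1 * cgauss t (y - p.1)) • f p.1)
      ((volume : Measure ℂ).prod (volume.restrict (Ioi 0))) := by
    refine AEStronglyMeasurable.smul ((hW.aestronglyMeasurable.comp_snd.mul ?_).mul ?_) ?_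
    · refine Measurable.aestronglyMeasurable ?_
      unfold cgauss
      fun_prop
    · exact ((continuous_cgauss t).comp (by fun_prop)).aestronglyMeasurable
    · exact (hf.comp continuous_fst).aestronglyMeasurable
  have hpt : ∀ g ∈ Ioi (0 : ℝ), ∀ x, (W g * cgauss (g ^ 2) x * cgauss t (y - x)) • f x =
      (W g * cgauss (g ^ 2 + t) y) • cgauss (g ^ 2 * t / (g ^ 2 + t))
        (x - ((g ^ 2 / (g ^ 2 + t) : ℝ) : ℂ) * y) • f x := fun g hg x => by
    rw [mul_assoc, cgauss_mul_cgauss_sub (pow_pos hg 2) ht, ← mul_assoc, mul_smul]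
  refine (integrable_prod_iff' hmeas).2 ⟨?_, ?_⟩
  · filter_upwards [ae_restrict_mem measurableSet_Ioi] with g hg
    have hg' : 0 < g := hg
    simp only [hpt g hg]
    exact (integrable_smul_cgauss_sub (by positivity) _ hf hfC).smul _
  · refine Integrable.mono' (hW.norm.mul_const ((Real.pi * t)⁻¹ * (C * (1 + t + ‖y‖ ^ 2))))
      hmeas.norm.prod_swap.integral_prod_right' ?_
    filter_upwards [ae_restrict_mem measurableSet_Ioi] with g hg
    have hg' : 0 < g := hg
    have hv : 0 < g ^ 2 * t / (g ^ 2 + t) := by positivity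
    set z : ℂ := ((g ^ 2 / (g ^ 2 + t) : ℝ) : ℂ) * y with hz
    rw [Real.norm_of_nonneg (integral_nonneg fun _ => norm_nonneg _)]
    simp only [hpt g hg, norm_smul (W g * _)]
    rw [integral_const_mul, norm_mul, Real.norm_of_nonneg (cgauss_nonneg (by positivity) y),
      mul_assoc]
    refine mul_le_mul_of_nonneg_left (mul_le_mul ?_ ?_ (integral_nonneg fun _ => norm_nonneg _)
      (by positivity)) (norm_nonneg _)
    · refine (cgauss_le (by positivity) y).trans ?_
      gcongr
      nlinarith
    · have h1 := (integrable_cgauss hv).comp_sub_right z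
      have h2 := integrable_smul_cgauss_sub hv z (f := fun x : ℂ => ‖x‖ ^ 2) (by fun_prop)
        (C := 1) fun x => by simp
      have hint : ∫ x, C * (cgauss (g ^ 2 * t / (g ^ 2 + t)) (x - z) +
          cgauss (g ^ 2 * t / (g ^ 2 + t)) (x - z) • ‖x‖ ^ 2) =
          C * (1 + (g ^ 2 * t / (g ^ 2 + t) + ‖z‖ ^ 2)) := by
        rw [integral_const_mul, integral_add h1 h2]
        simp only [smul_eq_mul]
        rw [integral_normSq_mul_cgauss_sub hv, integral_sub_right_eq_self, integral_cgauss hv]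
      refine (integral_mono_of_nonneg (.of_forall fun _ => norm_nonneg _)
        ((h1.add h2).const_mul C) (.of_forall fun x => ?_)).trans (hint.le.trans ?_)
      · simp only [norm_smul, Real.norm_of_nonneg (cgauss_nonneg hv _), Pi.add_apply, smul_eq_mul]
        refine (mul_le_mul_of_nonneg_left (hfC x) (cgauss_nonneg hv _)).trans_eq ?_
        ring
      · have hρ : g ^ 2 / (g ^ 2 + t) ≤ 1 := (div_le_one (by positivity)).2 (by linarith)
        have hw : g ^ 2 * t / (g ^ 2 + t) ≤ t := by
          rw [mul_div_right_comm]; exact mul_le_of_le_one_left ht.le hρ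
        have hzy : ‖z‖ ≤ ‖y‖ := by
          rw [hz, norm_mul, Complex.norm_real, Real.norm_of_nonneg (by positivity)]
          exact mul_le_of_le_one_left (norm_nonneg y) hρ
        rw [add_assoc]
        gcongr

/-- Observing a Gaussian scale mixture in Gaussian noise: integrate out the posterior for each
scale first. -/
theorem integral_scaleMixture_smul {E : Type*} [NormedAddCommGroup E] [NormedSpace ℝ E]
    {W : ℝ → ℝ} (hW : IntegrableOn W (Ioi 0)) {t : ℝ} (ht : 0 < t) (y : ℂ) {f : ℂ → E}
    (hf : Continuous f) {C : ℝ} (hfC : ∀ x, ‖f x‖ ≤ C * (1 + ‖x‖ ^ 2)) :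
    ∫ x, ((∫ g in Ioi (0 : ℝ), W g * cgauss (g ^ 2) x) * cgauss t (y - x)) • f x =
      ∫ g in Ioi (0 : ℝ), (W g * cgauss (g ^ 2 + t) y) •
        ∫ x, cgauss (g ^ 2 * t / (g ^ 2 + t)) (x - ((g ^ 2 / (g ^ 2 + t) : ℝ) : ℂ) * y) • f x := by
  by_cases hE : CompleteSpace E
  swap
  · simp [integral, hE]
  simp_rw [← integral_mul_const, ← integral_smul_const]
  rw [integral_integral_swap (integrable_scaleMixture_prod hW ht y hf hfC)]
  refine setIntegral_congr_fun measurableSet_Ioi fun g hg => ?_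
  rw [← integral_smul]
  congr 1 with x
  rw [mul_assoc, cgauss_mul_cgauss_sub (pow_pos hg 2) ht, ← mul_assoc, mul_smul]

/-- `∫₀^∞ W(g) g^{2j} (g²+t)^{-(j+1)} exp(-s/(g²+t)) dg`: up to the factor `π`, the `j`-th moment
of the shrinkage factor `g²/(g²+t)` against the likelihood of an observation of squared norm `s`. -/
def shrinkMoment (W : ℝ → ℝ) (t : ℝ) (j : ℕ) (s : ℝ) : ℝ :=
  ∫ g in Ioi (0 : ℝ), W g * ((g ^ 2) ^ j / (g ^ 2 + t) ^ (j + 1)) * Real.exp (-s / (g ^ 2 + t))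

theorem integrableOn_shrinkMoment {W : ℝ → ℝ} (hW : IntegrableOn W (Ioi 0)) {t : ℝ} (ht : 0 < t)
    (j : ℕ) {s : ℝ} (hs : 0 ≤ s) :
    IntegrableOn (fun g => W g * ((g ^ 2) ^ j / (g ^ 2 + t) ^ (j + 1)) *
      Real.exp (-s / (g ^ 2 + t))) (Ioi 0) := by
  have hb : ∀ g : ℝ, ‖(g ^ 2) ^ j / (g ^ 2 + t) ^ (j + 1) * Real.exp (-s / (g ^ 2 + t))‖ ≤ t⁻¹ :=
    fun g => by
      have hv : 0 < g ^ 2 + t := by positivity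
      rw [Real.norm_of_nonneg (by positivity)]
      have h1 : Real.exp (-s / (g ^ 2 + t)) ≤ 1 := by
        rw [Real.exp_le_one_iff, neg_div, Left.neg_nonpos_iff]
        positivity
      refine (mul_le_of_le_one_right (by positivity) h1).trans ?_
      rw [pow_succ (g ^ 2 + t), ← div_div, ← div_pow, div_eq_mul_inv]
      have h2 : g ^ 2 / (g ^ 2 + t) ≤ 1 := (div_le_one hv).2 (by linarith)
      refine (mul_le_of_le_one_left (by positivity) (pow_le_one₀ (by positivity) h2)).trans ?_
      gcongr
      nlinarith
  have h := Integrable.bdd_mul hW (f := fun g : ℝ =>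
    (g ^ 2) ^ j / (g ^ 2 + t) ^ (j + 1) * Real.exp (-s / (g ^ 2 + t)))
    (Measurable.aestronglyMeasurable (by fun_prop)) (.of_forall hb)
  refine h.congr (.of_forall fun g => ?_)
  simp only
  ring

theorem measurable_shrinkMoment {W : ℝ → ℝ} (hW : Measurable W) (t : ℝ) (j : ℕ) :
    Measurable (shrinkMoment W t j) := by
  refine (StronglyMeasurable.integral_prod_right (f := fun s g : ℝ =>
    W g * ((g ^ 2) ^ j / (g ^ 2 + t) ^ (j + 1)) * Real.exp (-s / (g ^ 2 + t))) ?_).measurable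
  refine Measurable.stronglyMeasurable ?_
  unfold Function.uncurry
  fun_prop

theorem integral_scaleMixture_evidence {W : ℝ → ℝ} (hW : IntegrableOn W (Ioi 0)) {t : ℝ}
    (ht : 0 < t) (y : ℂ) :
    ∫ x, (∫ g in Ioi (0 : ℝ), W g * cgauss (g ^ 2) x) * cgauss t (y - x) =
      Real.pi⁻¹ * shrinkMoment W t 0 (‖y‖ ^ 2) := by
  have h := integral_scaleMixture_smul hW ht y (f := fun _ => (1 : ℝ)) continuous_const (C := 1)
    fun x => by simp
  simp only [smul_eq_mul, mul_one] at h
  rw [h, shrinkMoment, ← integral_const_mul]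
  refine setIntegral_congr_fun measurableSet_Ioi fun g hg => ?_
  have hg' : 0 < g := hg
  rw [integral_sub_right_eq_self, integral_cgauss (by positivity), cgauss]
  field_simp
  ring

theorem integral_scaleMixture_mean {W : ℝ → ℝ} (hW : IntegrableOn W (Ioi 0)) {t : ℝ}
    (ht : 0 < t) (y : ℂ) :
    ∫ x, ((∫ g in Ioi (0 : ℝ), W g * cgauss (g ^ 2) x) * cgauss t (y - x)) • x =
      (Real.pi⁻¹ * shrinkMoment W t 1 (‖y‖ ^ 2)) • y := by
  have h := integral_scaleMixture_smul hW ht y (f := fun x => x) continuous_id (C := 1)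
    fun x => by nlinarith [sq_nonneg (‖x‖ - 1)]
  rw [h, shrinkMoment, ← integral_const_mul, ← integral_smul_const]
  refine setIntegral_congr_fun measurableSet_Ioi fun g hg => ?_
  have hg' : 0 < g := hg
  rw [integral_mul_cgauss_sub (by positivity), ← Complex.real_smul, smul_smul, cgauss]
  congr 1
  field_simp

theorem integral_scaleMixture_normSq {W : ℝ → ℝ} (hW : IntegrableOn W (Ioi 0)) {t : ℝ}
    (ht : 0 < t) (y : ℂ) :
    ∫ x, (∫ g in Ioi (0 : ℝ), W g * cgauss (g ^ 2) x) * cgauss t (y - x) * ‖x‖ ^ 2 =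
      Real.pi⁻¹ * (t * shrinkMoment W t 1 (‖y‖ ^ 2) +
        ‖y‖ ^ 2 * shrinkMoment W t 2 (‖y‖ ^ 2)) := by
  have h := integral_scaleMixture_smul hW ht y (f := fun x => ‖x‖ ^ 2) (by fun_prop) (C := 1)
    fun x => by simp
  simp only [smul_eq_mul] at h
  have h1 := (integrableOn_shrinkMoment hW ht 1 (sq_nonneg ‖y‖)).const_mul t
  have h2 := (integrableOn_shrinkMoment hW ht 2 (sq_nonneg ‖y‖)).const_mul (‖y‖ ^ 2)
  rw [h, shrinkMoment, shrinkMoment, ← integral_const_mul, ← integral_const_mul,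
    ← integral_add h1 h2, ← integral_const_mul]
  refine setIntegral_congr_fun measurableSet_Ioi fun g hg => ?_
  have hg' : 0 < g := hg
  rw [integral_normSq_mul_cgauss_sub (by positivity), norm_mul, Complex.norm_real,
    Real.norm_of_nonneg (by positivity), cgauss]
  field_simp
  ring

theorem integrable_mul_exp_kernel_prod {W : ℝ → ℝ} (hW : IntegrableOn W (Ioi 0)) {t : ℝ}
    (ht : 0 < t) (k : ℕ) {h : ℝ → ℝ} (hh : Measurable h) {C : ℝ}
    (hC : ∀ g, |h g| * (g ^ 2 + t) ^ (k + 1) ≤ C) :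
    Integrable (fun p : ℝ × ℝ => W p.2 * h p.2 * (p.1 ^ k * Real.exp (-p.1 / (p.2 ^ 2 + t))))
      ((volume.restrict (Ioi 0)).prod (volume.restrict (Ioi 0))) := by
  have hmeas : AEStronglyMeasurable
      (fun p : ℝ × ℝ => W p.2 * h p.2 * (p.1 ^ k * Real.exp (-p.1 / (p.2 ^ 2 + t))))
      ((volume.restrict (Ioi 0)).prod (volume.restrict (Ioi 0))) :=
    (hW.aestronglyMeasurable.comp_snd.mul
      (hh.comp measurable_snd).aestronglyMeasurable).mul
      (Measurable.aestronglyMeasurable (by fun_prop))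
  refine (integrable_prod_iff' hmeas).2 ⟨.of_forall fun g => ?_, ?_⟩
  · exact (integrableOn_pow_mul_exp_neg_div (v := g ^ 2 + t) (by positivity) k).const_mul
      (W g * h g)
  · refine Integrable.mono' (hW.norm.mul_const (k.factorial * C))
      hmeas.norm.prod_swap.integral_prod_right' (.of_forall fun g => ?_)
    rw [Real.norm_of_nonneg (integral_nonneg fun _ => norm_nonneg _)]
    have hv : 0 < g ^ 2 + t := by positivity
    have hnorm : ∀ s ∈ Ioi (0 : ℝ), ‖W g * h g * (s ^ k * Real.exp (-s / (g ^ 2 + t)))‖ =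
        ‖W g‖ * |h g| * (s ^ k * Real.exp (-s / (g ^ 2 + t))) := fun s hs => by
      have hs' : 0 < s := hs
      rw [norm_mul, norm_mul, Real.norm_eq_abs (h g),
        Real.norm_of_nonneg (by positivity : 0 ≤ s ^ k * Real.exp (-s / (g ^ 2 + t)))]
    rw [setIntegral_congr_fun measurableSet_Ioi hnorm, integral_const_mul,
      integral_pow_mul_exp_neg_div hv, mul_assoc, mul_left_comm |h g|]
    gcongr
    exact hC g

theorem integrableOn_shrinkMoment_one {W : ℝ → ℝ} (hW : IntegrableOn W (Ioi 0)) {t : ℝ}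
    (ht : 0 < t) :
    IntegrableOn (shrinkMoment W t 1) (Ioi 0) ∧
      ∫ s in Ioi (0 : ℝ), shrinkMoment W t 1 s =
        ∫ g in Ioi (0 : ℝ), W g * (g ^ 2 / (g ^ 2 + t)) := by
  have hi := integrable_mul_exp_kernel_prod hW ht 0
    (h := fun g => (g ^ 2) ^ 1 / (g ^ 2 + t) ^ (1 + 1)) (by fun_prop) (C := 1) fun g => by
      have hv : 0 < g ^ 2 + t := by positivity
      rw [abs_of_nonneg (by positivity)]
      field_simp
      simp only [zero_add, pow_one, one_add_one_eq_two]
      nlinarith [mul_pos ht hv]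
  simp only [pow_zero, one_mul] at hi
  refine ⟨hi.integral_prod_left, ?_⟩
  unfold shrinkMoment
  rw [integral_integral_swap hi]
  congr 1 with g
  have hv : 0 < g ^ 2 + t := by positivity
  have h0 := integral_pow_mul_exp_neg_div hv 0
  simp only [pow_zero, one_mul, zero_add, pow_one, Nat.factorial_zero, Nat.cast_one] at h0
  rw [integral_const_mul, h0]
  field_simp

theorem integrableOn_mul_shrinkMoment_sub {W : ℝ → ℝ} (hW : IntegrableOn W (Ioi 0)) {t : ℝ}
    (ht : 0 < t) :
    IntegrableOn (fun s => s * (shrinkMoment W t 0 s - shrinkMoment W t 1 s)) (Ioi 0) := by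
  have hi := integrable_mul_exp_kernel_prod hW ht 1
    (h := fun g => t / (g ^ 2 + t) ^ 2) (by fun_prop) (C := t) fun g => by
      have hv : 0 < g ^ 2 + t := by positivity
      rw [abs_of_nonneg (by positivity)]
      field_simp
      exact le_rfl
  refine IntegrableOn.congr_fun (f := fun s => ∫ g in Ioi (0 : ℝ), W g * (t / (g ^ 2 + t) ^ 2) *
    (s ^ 1 * Real.exp (-s / (g ^ 2 + t)))) hi.integral_prod_left (fun s hs => ?_) measurableSet_Ioi
  have hs' : 0 ≤ s := le_of_lt hs
  simp only [shrinkMoment]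
  rw [← integral_sub (integrableOn_shrinkMoment hW ht 0 hs')
    (integrableOn_shrinkMoment hW ht 1 hs'), ← integral_const_mul]
  congr 1 with g
  have hv : 0 < g ^ 2 + t := by positivity
  field_simp
  ring

theorem shrinkMoment_nonneg {W : ℝ → ℝ} (hW0 : ∀ g, 0 < g → 0 ≤ W g) {t : ℝ} (ht : 0 < t) (j : ℕ)
    (s : ℝ) : 0 ≤ shrinkMoment W t j s :=
  setIntegral_nonneg measurableSet_Ioi fun g hg => by
    have := hW0 g hg
    positivity

theorem shrinkMoment_succ_le {W : ℝ → ℝ} (hW : IntegrableOn W (Ioi 0))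
    (hW0 : ∀ g, 0 < g → 0 ≤ W g) {t : ℝ} (ht : 0 < t) (j : ℕ) {s : ℝ} (hs : 0 ≤ s) :
    shrinkMoment W t (j + 1) s ≤ shrinkMoment W t j s := by
  refine setIntegral_mono_on (integrableOn_shrinkMoment hW ht _ hs)
    (integrableOn_shrinkMoment hW ht _ hs) measurableSet_Ioi fun g hg => ?_
  have hg0 := hW0 g hg
  have hv : 0 < g ^ 2 + t := by positivity
  gcongr W g * ?_ * _
  rw [pow_succ (g ^ 2), pow_succ _ (j + 1), mul_div_mul_comm]
  exact mul_le_of_le_one_right (by positivity) ((div_le_one hv).2 (by linarith))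

theorem shrinkMoment_convex {W : ℝ → ℝ} (hW : IntegrableOn W (Ioi 0))
    (hW0 : ∀ g, 0 < g → 0 ≤ W g) {t : ℝ} (ht : 0 < t) {s : ℝ} (hs : 0 ≤ s) :
    2 * shrinkMoment W t 1 s ≤ shrinkMoment W t 2 s + shrinkMoment W t 0 s := by
  have h0 := integrableOn_shrinkMoment hW ht 0 hs
  have h1 := integrableOn_shrinkMoment hW ht 1 hs
  have h2 := integrableOn_shrinkMoment hW ht 2 hs
  unfold shrinkMoment
  rw [← integral_const_mul, ← integral_add h2 h0]
  refine setIntegral_mono_on (h1.const_mul 2) (h2.add h0) measurableSet_Ioi fun g hg => ?_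
  have hg0 := hW0 g hg
  have hv : 0 < g ^ 2 + t := by positivity
  rw [← add_mul, ← mul_add, ← mul_assoc, mul_left_comm]
  gcongr W g * ?_ * _
  rw [← sub_nonneg]
  have : (g ^ 2) ^ 2 / (g ^ 2 + t) ^ (2 + 1) + (g ^ 2) ^ 0 / (g ^ 2 + t) ^ (0 + 1) -
      2 * ((g ^ 2) ^ 1 / (g ^ 2 + t) ^ (1 + 1)) = t ^ 2 / (g ^ 2 + t) ^ 3 := by
    field_simp
    ring
  rw [this]
  positivity

theorem abs_sub_sq_div_le {x n m : ℝ} (hx : 0 < x) (hm : 0 ≤ m) (hmn : m ≤ n)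
    (hconv : 2 * n ≤ m + x) : |m - n ^ 2 / x| ≤ x - n := by
  have hle : n ^ 2 / x ≤ n := by
    rw [div_le_iff₀ hx]
    nlinarith
  have hge : 2 * n - x ≤ n ^ 2 / x := by
    rw [le_div_iff₀ hx]
    nlinarith [sq_nonneg (n - x)]
  rw [abs_le]
  constructor <;> linarith

/-- The excess risk caused by not knowing the scale is integrable; `κ` is the weight of the atom
at the origin. -/
theorem integrableOn_excess {W : ℝ → ℝ} (hWm : Measurable W) (hW : IntegrableOn W (Ioi 0))
    (hW0 : ∀ g, 0 < g → 0 ≤ W g) {t : ℝ} (ht : 0 < t) {κ : ℝ} (hκ : 0 < κ) :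
    IntegrableOn (fun s => s * (shrinkMoment W t 2 s - shrinkMoment W t 1 s ^ 2 /
      (κ * Real.exp (-s / t) + shrinkMoment W t 0 s))) (Ioi 0) := by
  have hatom := (integrableOn_pow_mul_exp_neg_div ht 1).const_mul κ
  simp only [pow_one] at hatom
  refine Integrable.mono' (hatom.add (integrableOn_mul_shrinkMoment_sub hW ht)) ?_ ?_
  · have := measurable_shrinkMoment hWm t
    exact Measurable.aestronglyMeasurable (by fun_prop)
  · filter_upwards [ae_restrict_mem measurableSet_Ioi] with s hs
    have hs' : 0 < s := hs
    have he : 0 < κ * Real.exp (-s / t) := by positivity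
    have h0 := shrinkMoment_nonneg hW0 ht 0 s
    have hb := abs_sub_sq_div_le (add_pos_of_pos_of_nonneg he h0)
      (shrinkMoment_nonneg hW0 ht 2 s) (shrinkMoment_succ_le hW hW0 ht 1 hs'.le)
      (by linarith [shrinkMoment_convex hW hW0 ht hs'.le])
    rw [norm_mul, Real.norm_of_nonneg hs'.le, Real.norm_eq_abs]
    refine (mul_le_mul_of_nonneg_left hb hs'.le).trans_eq ?_
    simp only [Pi.add_apply]
    ring

theorem Qfun_nonneg (b c g : ℝ) : 0 ≤ Qfun b c g :=
  integral_nonneg fun _ => (Real.exp_pos _).le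

theorem integrable_exp_neg_sq : Integrable fun s : ℝ => Real.exp (-s ^ 2) := by
  simpa using integrable_exp_neg_mul_sq one_pos

theorem measurable_Qfun (b c : ℝ) : Measurable (Qfun b c) := by
  have hanti : Antitone fun u : ℝ => ∫ s in Ioi u, Real.exp (-s ^ 2) := fun u v huv =>
    setIntegral_mono_set integrable_exp_neg_sq.integrableOn
      (.of_forall fun _ => (Real.exp_pos _).le) (Ioi_subset_Ioi huv).eventuallyLE
  exact hanti.measurable.comp (by fun_prop : Measurable fun g => b * Real.log g + c)

theorem Qfun_le_integral (b c g : ℝ) : Qfun b c g ≤ ∫ s : ℝ, Real.exp (-s ^ 2) :=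
  setIntegral_le_integral integrable_exp_neg_sq (.of_forall fun _ => (Real.exp_pos _).le)

theorem Qfun_le_exp (b c g : ℝ) {K : ℝ} (hK : 0 < K) :
    Qfun b c g ≤ Real.exp (K ^ 2 / 4) / K * Real.exp (-K * (b * Real.log g + c)) := by
  have hexp := integrableOn_exp_mul_Ioi (neg_lt_zero.2 hK) (b * Real.log g + c)
  have h : Qfun b c g ≤ ∫ s in Ioi (b * Real.log g + c),
      Real.exp (K ^ 2 / 4) * Real.exp (-K * s) := by
    refine integral_mono integrable_exp_neg_sq.integrableOn (hexp.const_mul _) fun s => ?_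
    simp only
    rw [← Real.exp_add, Real.exp_le_exp]
    nlinarith [sq_nonneg (s - K / 2)]
  rw [integral_const_mul, integral_exp_mul_Ioi (neg_lt_zero.2 hK)] at h
  refine h.trans_eq ?_
  field_simp

theorem integrableOn_rpow_mul_Qfun {b γ : ℝ} (hb : b < 0) (hγ : 1 < γ) (c : ℝ) :
    IntegrableOn (fun g => g ^ (-γ) * Qfun b c g) (Ioi 0) := by
  have hmeas : Measurable fun g => g ^ (-γ) * Qfun b c g :=
    (by fun_prop : Measurable fun g : ℝ => g ^ (-γ)).mul (measurable_Qfun b c)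
  rw [← Ioc_union_Ioi_eq_Ioi zero_le_one]
  refine IntegrableOn.union ?_ ?_
  · set K := γ / -b with hKdef
    have hK : 0 < K := div_pos (by linarith) (by linarith)
    refine Integrable.mono' (integrable_const (Real.exp (K ^ 2 / 4) / K * Real.exp (-K * c)))
      hmeas.aestronglyMeasurable ?_
    filter_upwards [ae_restrict_mem measurableSet_Ioc] with g hg
    have hg0 : 0 < g := hg.1
    have hpow : g ^ (-γ) = Real.exp (K * (b * Real.log g)) := by
      rw [Real.rpow_def_of_pos hg0, hKdef]
      congr 1
      field_simp [hb.ne]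
    rw [Real.norm_of_nonneg (mul_nonneg (by positivity) (Qfun_nonneg b c g))]
    refine (mul_le_mul_of_nonneg_left (Qfun_le_exp b c g hK) (by positivity)).trans_eq ?_
    rw [hpow, mul_left_comm, ← Real.exp_add]
    congr 2
    ring
  · refine Integrable.mono' ((integrableOn_Ioi_rpow_of_lt (neg_lt_neg hγ) one_pos).mul_const
      (∫ s : ℝ, Real.exp (-s ^ 2))) hmeas.aestronglyMeasurable ?_
    filter_upwards [ae_restrict_mem measurableSet_Ioi] with g hg
    have hg0 : 0 < g := zero_lt_one.trans hg
    rw [Real.norm_of_nonneg (mul_nonneg (by positivity) (Qfun_nonneg b c g))]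
    exact mul_le_mul_of_nonneg_left (Qfun_le_integral b c g) (by positivity)

theorem pH_eq_scaleMixture (a γ b c : ℝ) (x : ℂ) :
    pH a γ b c x = a * ∫ g in Ioi (0 : ℝ), g ^ (-γ) * Qfun b c g * cgauss (g ^ 2) x := by
  rw [pH, div_mul_eq_mul_div, mul_div_assoc, div_eq_inv_mul (∫ _ in _, _), ← integral_const_mul]
  congr 1
  refine setIntegral_congr_fun measurableSet_Ioi fun g hg => ?_
  have hg' : 0 < g := hg
  rw [cgauss, Real.rpow_sub hg', Real.rpow_two]
  field_simp

theorem mufun_eq_shrinkMoment (γ b c τ s : ℝ) :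
    mufun γ b c τ 1 s = shrinkMoment (fun g => g ^ (-γ) * Qfun b c g) (τ ^ 2) 2 s := by
  refine setIntegral_congr_fun measurableSet_Ioi fun g hg => ?_
  have hg' : 0 < g := hg
  simp only
  rw [sub_eq_add_neg, Real.rpow_add hg', show (4 : ℝ) = (4 : ℕ) by norm_num, Real.rpow_natCast]
  ring

theorem nufun_eq_shrinkMoment (γ b c τ s : ℝ) :
    nufun γ b c τ 1 s = shrinkMoment (fun g => g ^ (-γ) * Qfun b c g) (τ ^ 2) 1 s := by
  refine setIntegral_congr_fun measurableSet_Ioi fun g hg => ?_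
  have hg' : 0 < g := hg
  simp only
  rw [sub_eq_add_neg, Real.rpow_add hg', Real.rpow_two]
  ring

theorem xifun_eq_shrinkMoment (a γ b c τ lam s : ℝ) :
    xifun a γ b c τ lam 1 s = (1 - lam) / (lam * a * τ ^ 2) * Real.exp (-s / τ ^ 2) +
      shrinkMoment (fun g => g ^ (-γ) * Qfun b c g) (τ ^ 2) 0 s := by
  rw [xifun, mul_one, shrinkMoment]
  congr 2 with g
  rw [pow_zero, zero_add]
  ring

/-- the Bayes risk (MSE of the MMSE denoiser) for the prior `(1-λ)δ₀ + λ p_H`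
under complex Gaussian noise of variance `τ²`. -/
theorem stmt6
    (R α β σ : ℝ) (hR : 0 < R) (hβ : 0 < β) (hσ : 0 < σ)
    (γ a b c : ℝ)
    (hγ : γ = 40 / β + 1)
    (ha : a = 40 / (R ^ 2 * β * Real.sqrt Real.pi) *
      Real.exp (2 * (Real.log 10) ^ 2 * σ ^ 2 / β ^ 2 - 2 * (Real.log 10) * α / β))
    (hb : b = -10 * Real.sqrt 2 / ((Real.log 10) * σ))
    (hc : c = (-α - β * Real.logb 10 R) / (Real.sqrt 2 * σ) - 20 / (β * b))
    (τ lam : ℝ) (hτ : 0 < τ) (hlam : lam ∈ Set.Ioo (0 : ℝ) 1)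
    (m A : ℂ → ℝ) (B : ℂ → ℂ)
    (hm : ∀ xt, m xt = (1 - lam) * cgauss (τ ^ 2) xt +
      lam * ∫ x : ℂ, pH a γ b c x * cgauss (τ ^ 2) (xt - x))
    (hB : ∀ xt, B xt = (lam : ℂ) *
      ∫ x : ℂ, x * ((pH a γ b c x * cgauss (τ ^ 2) (xt - x) : ℝ) : ℂ))
    (hA : ∀ xt, A xt = lam * ∫ x : ℂ, ‖x‖ ^ 2 * (pH a γ b c x * cgauss (τ ^ 2) (xt - x))) :
    ∫ xt : ℂ, (A xt - ‖B xt‖ ^ 2 / m xt) =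
      (∫ g in Set.Ioi (0 : ℝ),
        a * Qfun b c g * g ^ (-γ) * (lam * g ^ 2 * τ ^ 2 / (g ^ 2 + τ ^ 2))) +
      ∫ s in Set.Ioi (0 : ℝ),
        a * lam * s * (mufun γ b c τ 1 s - (nufun γ b c τ 1 s) ^ 2 / xifun a γ b c τ lam 1 s) := by
  have hlam0 : 0 < lam := hlam.1
  have hpi := Real.pi_pos
  have ht : 0 < τ ^ 2 := by positivity
  have ha0 : 0 < a := by rw [ha]; positivity
  have hlog : 0 < Real.log 10 := Real.log_pos (by norm_num)
  have hb0 : b < 0 := by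
    rw [hb, neg_mul, neg_div, neg_lt_zero]
    positivity
  have hγ1 : 1 < γ := by
    have : 0 < 40 / β := by positivity
    linarith
  set W : ℝ → ℝ := fun g => g ^ (-γ) * Qfun b c g with hWdef
  have hW : IntegrableOn W (Ioi 0) := integrableOn_rpow_mul_Qfun hb0 hγ1 c
  have hWm : Measurable W :=
    (by fun_prop : Measurable fun g : ℝ => g ^ (-γ)).mul (measurable_Qfun b c)
  have hW0 : ∀ g, 0 < g → 0 ≤ W g := fun g hg => mul_nonneg (by positivity) (Qfun_nonneg b c g)
  set κ : ℝ := (1 - lam) / (lam * a * τ ^ 2) with hκdef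
  have hκ : 0 < κ := div_pos (sub_pos.2 hlam.2) (by positivity)
  set M : ℕ → ℝ → ℝ := shrinkMoment W (τ ^ 2) with hMdef
  set ξ : ℝ → ℝ := fun s => κ * Real.exp (-s / τ ^ 2) + M 0 s with hξdef
  have hξ : ∀ s, 0 < ξ s := fun s =>
    add_pos_of_pos_of_nonneg (by positivity) (shrinkMoment_nonneg hW0 ht 0 s)
  have hpH : ∀ x, pH a γ b c x = a * ∫ g in Ioi (0 : ℝ), W g * cgauss (g ^ 2) x :=
    pH_eq_scaleMixture a γ b c
  have hm' : ∀ y, m y = lam * a / Real.pi * ξ (‖y‖ ^ 2) := fun y => by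
    rw [hm]
    simp_rw [hpH, mul_assoc a]
    rw [integral_const_mul, integral_scaleMixture_evidence hW ht, ← hMdef, cgauss]
    simp only [hξdef, hκdef]
    field_simp
  have hB' : ∀ y, B y = ((lam * a / Real.pi * M 1 (‖y‖ ^ 2) : ℝ) : ℂ) * y := fun y => by
    have hcomm : ∀ x : ℂ, x * ((pH a γ b c x * cgauss (τ ^ 2) (y - x) : ℝ) : ℂ) =
        a • (((∫ g in Ioi (0 : ℝ), W g * cgauss (g ^ 2) x) * cgauss (τ ^ 2) (y - x)) • x) :=
      fun x => by
        rw [hpH, smul_smul, mul_comm x, Complex.real_smul, mul_assoc]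
    rw [hB]
    simp_rw [hcomm]
    rw [integral_smul, integral_scaleMixture_mean hW ht, ← hMdef, smul_smul, ← Complex.real_smul,
      ← Complex.real_smul, smul_smul]
    congr 1
    field_simp
  have hA' : ∀ y, A y = lam * a / Real.pi *
      (τ ^ 2 * M 1 (‖y‖ ^ 2) + ‖y‖ ^ 2 * M 2 (‖y‖ ^ 2)) := fun y => by
    have hcomm : ∀ x : ℂ, ‖x‖ ^ 2 * (pH a γ b c x * cgauss (τ ^ 2) (y - x)) =
        a * ((∫ g in Ioi (0 : ℝ), W g * cgauss (g ^ 2) x) * cgauss (τ ^ 2) (y - x) * ‖x‖ ^ 2) :=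
      fun x => by
        rw [hpH]
        ring
    rw [hA]
    simp_rw [hcomm]
    rw [integral_const_mul, integral_scaleMixture_normSq hW ht, ← hMdef]
    field_simp
  have hrisk : ∀ y, A y - ‖B y‖ ^ 2 / m y = lam * a / Real.pi * (τ ^ 2 * M 1 (‖y‖ ^ 2) +
      ‖y‖ ^ 2 * (M 2 (‖y‖ ^ 2) - M 1 (‖y‖ ^ 2) ^ 2 / ξ (‖y‖ ^ 2))) := fun y => by
    rw [hA', hB', hm', norm_mul, Complex.norm_real, mul_pow, Real.norm_eq_abs, sq_abs]
    have := (hξ (‖y‖ ^ 2)).ne'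
    field_simp
    ring
  obtain ⟨hM1, hM1'⟩ := integrableOn_shrinkMoment_one hW ht
  simp_rw [hrisk]
  rw [integral_comp_normSq fun s => lam * a / Real.pi * (τ ^ 2 * M 1 s +
      s * (M 2 s - M 1 s ^ 2 / ξ s)), integral_const_mul,
    integral_add (hM1.const_mul _) (integrableOn_excess hWm hW hW0 ht hκ), integral_const_mul,
    hM1', ← mul_assoc, mul_div_cancel₀ _ hpi.ne', mul_add, ← mul_assoc, ← integral_const_mul,
    ← integral_const_mul]
  congr 1
  · congr 1 with g
    simp only [hWdef]
    ring
  · congr 1 with s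
    rw [mufun_eq_shrinkMoment, nufun_eq_shrinkMoment, xifun_eq_shrinkMoment]
    simp only [hWdef]
    ring
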